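/- Let (R,m) be a Noetherian local ring of dimension d, Q ⊆ R a parameter ideal, and B any balanced big Cohen–Macaulay R-algebra. Then ℓ(R/(Q^{n+1})^B) ≤ binom(n+d,d)·e(Q,R) for all n ≥ 0, where (Q^{n+1})^B := Q^{n+1}B ∩ R and e(Q,R) is the Hilbert–Samuel multiplicity of Q. -/

import Mathlib

open IsLocalRing

universe u

section BasicDefs

variable (R : Type*) [CommRing R]

/-- The length of a module, i.e. the Krull dimension of its lattice of submodules. -/
noncomputable def moduleLength (M : Type*) [AddCommGroup M] [Module R M] : WithBot ℕ∞ :=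
  Order.krullDim (Submodule R M)

/-- A system of parameters of a Noetherian local ring: `d` elements generating an
ideal whose radical is the maximal ideal, where `d` is the Krull dimension. -/
def IsSOP [IsLocalRing R] {d : ℕ} (x : Fin d → R) : Prop :=
  ringKrullDim R = (d : WithBot ℕ∞) ∧
    (Ideal.span (Set.range x)).radical = maximalIdeal R

/-- A parameter ideal is an ideal generated by a system of parameters. -/
def IsParameterIdeal [IsLocalRing R] (Q : Ideal R) : Prop :=
  ∃ (d : ℕ) (x : Fin d → R), IsSOP R x ∧ Q = Ideal.span (Set.range x)

/-- `f : R →+* B` makes `B` a balanced big Cohen-Macaulay `R`-algebra if every system of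
parameters of `R` maps to a regular sequence on `B` and `m·B ≠ B`. -/
def IsBalancedBigCMHom [IsLocalRing R] {B : Type*} [CommRing B] (f : R →+* B) : Prop :=
  (∀ (d : ℕ) (x : Fin d → R), IsSOP R x →
      RingTheory.Sequence.IsRegular B (List.ofFn fun i => f (x i))) ∧
    (maximalIdeal R).map f ≠ ⊤

/-- A balanced big Cohen-Macaulay algebra. -/
def IsBalancedBigCM [IsLocalRing R] (B : Type*) [CommRing B] [Algebra R B] : Prop :=
  IsBalancedBigCMHom R (algebraMap R B)

/-- The integral closure of an ideal `I`, as a set: all `x` satisfying an equation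
`x^n + a₁ x^{n-1} + ⋯ + aₙ = 0` with `aₖ ∈ I^k`. -/
def intClSet (I : Ideal R) : Set R :=
  { x | ∃ n : ℕ, 0 < n ∧ ∃ a : ℕ → R,
      (∀ k ∈ Finset.Icc 1 n, a k ∈ I ^ k) ∧
      x ^ n + ∑ k ∈ Finset.Icc 1 n, a k * x ^ (n - k) = 0 }

/-- `I^B := IB ∩ R`, the contraction of the extension of `I` along `f : R →+* B`. -/
def contractedExt {B : Type*} [CommRing B] (f : R →+* B) (I : Ideal R) : Ideal R :=
  (I.map f).comap f

/-- Condition (†): `I^B ⊆ \bar I` for every m-primary ideal `I`. -/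
def SatisfiesDagger [IsLocalRing R] {B : Type*} [CommRing B] (f : R →+* B) : Prop :=
  ∀ I : Ideal R, I.radical = maximalIdeal R →
    (contractedExt R f I : Set R) ⊆ intClSet R I

/-- `e` is the family of Hilbert coefficients of the filtration `J` (in dimension `d`):
for `n ≫ 0`, `ℓ(R/J (n+1)) = ∑_{i≤d} (-1)^i e i * choose (n+d-i) (d-i)`. -/
def HasHilbertSeries (d : ℕ) (J : ℕ → Ideal R) (e : ℕ → ℤ) : Prop :=
  ∃ N : ℕ, ∀ n ≥ N, ∃ m : ℕ,
    moduleLength R (R ⧸ J (n + 1)) = (m : WithBot ℕ∞) ∧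
    (m : ℤ) = ∑ i ∈ Finset.range (d + 1),
      (-1) ^ i * e i * ((n + d - i).choose (d - i) : ℤ)

/-- Module version of `HasHilbertSeries`, for the `J`-adic filtration of a module `M`. -/
def HasHilbertSeriesMod (M : Type*) [AddCommGroup M] [Module R M] (d : ℕ)
    (J : Ideal R) (e : ℕ → ℤ) : Prop :=
  ∃ N : ℕ, ∀ n ≥ N, ∃ m : ℕ,
    moduleLength R (M ⧸ (J ^ (n + 1) • (⊤ : Submodule R M))) = (m : WithBot ℕ∞) ∧
    (m : ℤ) = ∑ i ∈ Finset.range (d + 1),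
      (-1) ^ i * e i * ((n + d - i).choose (d - i) : ℤ)


/-- The limit closure `(x₁,…,x_d)^{lim} = ⋃ₜ ((x₁^{t+1},…,x_d^{t+1}) : (x₁⋯x_d)^t)`. -/
def limitClosure {d : ℕ} (x : Fin d → R) : Ideal R :=
  ⨆ t : ℕ, (Ideal.span (Set.range fun i => x i ^ (t + 1))).colon
    (Ideal.span {(∏ i, x i) ^ t})

/-- A ring is equidimensional if `dim (R/P) = dim R` for every minimal prime `P`. -/
def IsEquidimensional : Prop :=
  ∀ P ∈ minimalPrimes R, ringKrullDim (R ⧸ P) = ringKrullDim R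

/-- Depth at least `n`: there is a regular sequence of length `n` in the
(Jacobson) radical, i.e. in the maximal ideal when `R` is local. -/
def HasDepthGE (n : ℕ) : Prop :=
  ∃ rs : List R, rs.length = n ∧ (∀ r ∈ rs, r ∈ (⊥ : Ideal R).jacobson) ∧
    RingTheory.Sequence.IsRegular R rs

/-- A Cohen-Macaulay (Noetherian) local ring: depth = dimension. -/
def IsCohenMacaulayLocalRing : Prop :=
  IsLocalRing R ∧ IsNoetherianRing R ∧
    ∃ d : ℕ, ringKrullDim R = (d : WithBot ℕ∞) ∧ HasDepthGE R d

/-- Serre's condition S₂: for every prime `P`,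
`depth R_P ≥ min 2 (dim R_P)`. -/
def SerreS2 : Prop :=
  ∀ (P : Ideal R) (hP : P.IsPrime) (n : ℕ),
    (n : WithBot ℕ∞) ≤ min 2 (ringKrullDim (Localization.AtPrime P)) →
    HasDepthGE (Localization.AtPrime P) n

/-- A regular local ring: a Noetherian local ring whose maximal ideal is generated
by `dim R` elements. -/
def IsRegularLocal : Prop :=
  IsLocalRing R ∧ IsNoetherianRing R ∧ ∃ (d : ℕ) (x : Fin d → R),
    ringKrullDim R = (d : WithBot ℕ∞) ∧
      Ideal.span (Set.range x) = (⊥ : Ideal R).jacobson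

/-- A regular (not necessarily local) ring: Noetherian and all localizations at
primes are regular local rings. -/
def IsRegularRing_ : Prop :=
  IsNoetherianRing R ∧
    ∀ (P : Ideal R) (hP : P.IsPrime), IsRegularLocal (Localization.AtPrime P)

/-- The tight closure of an ideal `I` in characteristic `p`, as a set. -/
def tightClSet (p : ℕ) (I : Ideal R) : Set R :=
  { x | ∃ c : R, (∀ P ∈ minimalPrimes R, c ∉ P) ∧
      ∃ E : ℕ, ∀ e ≥ E, c * x ^ p ^ e ∈ Ideal.span ((fun a => a ^ p ^ e) '' (I : Set R)) }

/-- F-rationality: every parameter ideal is tightly closed. -/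
def IsFRational [IsLocalRing R] (p : ℕ) : Prop :=
  ∀ Q : Ideal R, IsParameterIdeal R Q → tightClSet R p Q ⊆ (Q : Set R)

end BasicDefs

section Excellence

open TensorProduct

/-- Geometrically regular `k`-algebra (for `k` a field): `L ⊗[k] A` is regular
for every finite field extension `L` of `k`. -/
def IsGeometricallyRegular (k : Type u) (A : Type u) [CommRing k] [CommRing A]
    [Algebra k A] : Prop :=
  ∀ (L : Type u) [Field L] [Algebra k L], Module.Finite k L → IsRegularRing_ (L ⊗[k] A)

/-- `R` is a G-ring: for every prime `p`, the fibers of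
`R_p → (R_p)^∧` are geometrically regular. -/
def IsGRing (R : Type u) [CommRing R] : Prop :=
  ∀ (p : Ideal R) (hp : p.IsPrime) (q : Ideal (Localization.AtPrime p)) (hq : q.IsPrime),
    IsGeometricallyRegular
      (ResidueField (Localization.AtPrime q))
      ((ResidueField (Localization.AtPrime q))
        ⊗[Localization.AtPrime p]
        AdicCompletion (maximalIdeal (Localization.AtPrime p)) (Localization.AtPrime p))

/-- `R` is J-2: the regular locus of every finitely generated `R`-algebra is open. -/
def IsJ2 (R : Type u) [CommRing R] : Prop :=
  ∀ (A : Type u) [CommRing A] [Algebra R A], Algebra.FiniteType R A →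
    IsOpen { P : PrimeSpectrum A | IsRegularLocal (Localization.AtPrime P.asIdeal) }

/-- A catenary ring: any two saturated chains of primes with the same endpoints
have the same length. -/
def IsCatenary (A : Type*) [CommRing A] : Prop :=
  ∀ c₁ c₂ : LTSeries (PrimeSpectrum A),
    c₁.head = c₂.head → c₁.last = c₂.last →
    (∀ i : Fin c₁.length, c₁.toFun i.castSucc ⋖ c₁.toFun i.succ) →
    (∀ i : Fin c₂.length, c₂.toFun i.castSucc ⋖ c₂.toFun i.succ) →
    c₁.length = c₂.length

/-- Universally catenary: every finitely generated `R`-algebra is catenary. -/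
def IsUniversallyCatenary (R : Type u) [CommRing R] : Prop :=
  ∀ (A : Type u) [CommRing A] [Algebra R A], Algebra.FiniteType R A → IsCatenary A

/-- An excellent ring: Noetherian, a G-ring, J-2 and universally catenary. -/
def IsExcellentRing (R : Type u) [CommRing R] : Prop :=
  IsNoetherianRing R ∧ IsGRing R ∧ IsJ2 R ∧ IsUniversallyCatenary R

end Excellence

/-- `R` is BCM_B-rational (in dimension `d`): Cohen-Macaulay and the natural map
`H^d_m(R) → H^d_m(B)` is injective. -/
def IsBCMRational (R : Type u) [CommRing R] [IsLocalRing R]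
    (B : Type u) [CommRing B] [Algebra R B] (d : ℕ) : Prop :=
  IsCohenMacaulayLocalRing R ∧
    Function.Injective
      ((localCohomology (maximalIdeal R) d).map (ModuleCat.ofHom (Algebra.linearMap R B)))


namespace Stmt8Aux

open Finset

/-- exponents of degree at most `n` -/
noncomputable def expSet (d n : ℕ) : Finset (Fin d →₀ ℕ) :=
  (Finset.range (n + 1)).biUnion fun k => Finset.univ.finsuppAntidiag k

lemma mem_expSet {d n : ℕ} (a : Fin d →₀ ℕ) : a ∈ expSet d n ↔ ∑ i, a i ≤ n := by
  simp [expSet, Nat.lt_succ_iff]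

lemma urn {d : ℕ} (f : (Fin d →₀ ℕ) → ℕ)
    (hf : ∀ a i, f a ≤ f (a + Finsupp.single i 1)) (n : ℕ) :
    (n + d + 1) * ∑ a ∈ expSet d n, f a ≤ (n + 1) * ∑ a ∈ expSet d (n + 1), f a := by
  have hsub : expSet d n ⊆ expSet d (n + 1) := by
    intro a ha
    rw [mem_expSet] at *
    omega
  have h1 : (n + d + 1) * ∑ a ∈ expSet d n, f a =
      ∑ a ∈ expSet d n, (n + 1 - ∑ i, a i) * f a +
        ∑ i, ∑ a ∈ expSet d n, (a i + 1) * f a := by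
    rw [Finset.sum_comm, ← Finset.sum_add_distrib, Finset.mul_sum]
    refine Finset.sum_congr rfl fun a ha => ?_
    rw [mem_expSet] at ha
    rw [← Finset.sum_mul, ← add_mul, Finset.sum_add_distrib]
    congr 1
    simp
    omega
  have h2 : (n + 1) * ∑ a ∈ expSet d (n + 1), f a =
      ∑ a ∈ expSet d (n + 1), (n + 1 - ∑ i, a i) * f a +
        ∑ i, ∑ a ∈ expSet d (n + 1), a i * f a := by
    rw [Finset.sum_comm, ← Finset.sum_add_distrib, Finset.mul_sum]
    refine Finset.sum_congr rfl fun a ha => ?_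
    rw [mem_expSet] at ha
    rw [← Finset.sum_mul, ← add_mul]
    congr 1
    omega
  rw [h1, h2]
  refine add_le_add (Finset.sum_le_sum_of_subset hsub) (Finset.sum_le_sum fun i _ => ?_)
  calc ∑ a ∈ expSet d n, (a i + 1) * f a
      ≤ ∑ a ∈ expSet d n, (a + Finsupp.single i 1 : Fin d →₀ ℕ) i * f (a + Finsupp.single i 1) := by
        refine Finset.sum_le_sum fun a _ => ?_
        have := hf a i
        simp only [Finsupp.add_apply, Finsupp.single_eq_same]
        gcongr
    _ = ∑ b ∈ (expSet d n).map (addRightEmbedding (Finsupp.single i 1)), b i * f b := by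
        rw [Finset.sum_map]
        rfl
    _ ≤ _ := by
        refine Finset.sum_le_sum_of_subset ?_
        intro b hb
        rw [Finset.mem_map] at hb
        obtain ⟨a, ha, rfl⟩ := hb
        rw [mem_expSet] at *
        simp [Finset.sum_add_distrib, Finsupp.single_apply]
        exact ha

lemma choose_step (n d : ℕ) :
    (n + 1) * (n + 1 + d).choose d = (n + d + 1) * (n + d).choose d := by
  have := Nat.add_one_mul_choose_eq (n + d) n
  rw [show n + 1 + d = n + d + 1 by ring]
  have e1 : (n + d).choose n = (n + d).choose d := by
    rw [Nat.choose_symm_add]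
  have e2 : (n + d + 1).choose (n + 1) = (n + d + 1).choose d := by
    rw [show n + d + 1 = (n + 1) + d by ring, Nat.choose_symm_add]
  rw [e1, e2] at this
  linarith

lemma ratio_mono {d : ℕ} (L : ℕ → ℕ)
    (h : ∀ n, (n + d + 1) * L n ≤ (n + 1) * L (n + 1)) :
    Monotone fun n => (L n : ℝ) / ((n + d).choose d : ℝ) := by
  refine monotone_nat_of_le_succ fun n => ?_
  have p1 : 0 < ((n + d).choose d : ℝ) := by exact_mod_cast Nat.choose_pos (by omega)
  have p2 : 0 < ((n + 1 + d).choose d : ℝ) := by exact_mod_cast Nat.choose_pos (by omega)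
  rw [div_le_div_iff₀ p1 p2]
  have hc : ((n : ℝ) + 1) * (n + 1 + d).choose d = (n + d + 1) * (n + d).choose d := by
    exact_mod_cast choose_step n d
  have hL : ((n : ℝ) + d + 1) * L n ≤ (n + 1) * L (n + 1) := by exact_mod_cast h n
  have hn : (0 : ℝ) < n + 1 := by positivity
  refine le_of_mul_le_mul_left ?_ hn
  calc ((n : ℝ) + 1) * (L n * (n + 1 + d).choose d)
      = ((n : ℝ) + d + 1) * L n * (n + d).choose d := by linear_combination (L n : ℝ) * hc
    _ ≤ (n + 1) * L (n + 1) * (n + d).choose d := by gcongr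
    _ = _ := by ring

lemma choose_ratio_tendsto (d i : ℕ) (hi : 1 ≤ i) (hid : i ≤ d) :
    Filter.Tendsto (fun k : ℕ => ((k + d - i).choose (d - i) : ℝ) / ((k + d).choose d : ℝ))
      Filter.atTop (nhds 0) := by
  have hb : Filter.Tendsto (fun k : ℕ => (d : ℝ) / (k : ℝ)) Filter.atTop (nhds 0) :=
    tendsto_const_div_atTop_nhds_zero_nat _
  refine squeeze_zero' (Filter.Eventually.of_forall fun k => by positivity) ?_ hb
  filter_upwards [Filter.eventually_gt_atTop 0] with k hk
  have p1 : 0 < ((k + d).choose d : ℝ) := by exact_mod_cast Nat.choose_pos (by omega)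
  have hk' : (0 : ℝ) < k := by exact_mod_cast hk
  rw [div_le_div_iff₀ p1 hk']
  have h1 : (k + d - i).choose (d - i) ≤ (k + d - 1).choose (d - 1) := by
    have e1 : (k + d - i).choose (d - i) = (k + d - i).choose k := by
      rw [show k + d - i = k + (d - i) by omega, Nat.choose_symm_add]
    have e2 : (k + d - 1).choose (d - 1) = (k + d - 1).choose k := by
      rw [show k + d - 1 = k + (d - 1) by omega, Nat.choose_symm_add]
    rw [e1, e2]
    exact Nat.choose_le_choose _ (by omega)
  have h2 : (k + d) * (k + d - 1).choose (d - 1) = (k + d).choose d * d := by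
    have := Nat.add_one_mul_choose_eq (k + d - 1) (d - 1)
    rwa [show k + d - 1 + 1 = k + d by omega, show d - 1 + 1 = d by omega] at this
  have h3 : (k + d - i).choose (d - i) * k ≤ d * (k + d).choose d := by
    calc (k + d - i).choose (d - i) * k ≤ (k + d - 1).choose (d - 1) * (k + d) := by
          gcongr; omega
      _ = _ := by rw [mul_comm, h2, mul_comm]
  exact_mod_cast h3

lemma numeric {d : ℕ} (L : ℕ → ℕ) (e : ℕ → ℤ) (N : ℕ)
    (h : ∀ n, (n + d + 1) * L n ≤ (n + 1) * L (n + 1))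
    (hL : ∀ k ≥ N, (L k : ℤ) ≤ ∑ i ∈ Finset.range (d + 1),
      (-1) ^ i * e i * ((k + d - i).choose (d - i) : ℤ)) (n : ℕ) :
    (L n : ℤ) ≤ ((n + d).choose d : ℤ) * e 0 := by
  have hm := ratio_mono L h
  have ht : Filter.Tendsto (fun k : ℕ => (∑ i ∈ Finset.range (d + 1),
      (-1 : ℝ) ^ i * e i * ((k + d - i).choose (d - i) : ℝ)) / ((k + d).choose d : ℝ))
      Filter.atTop (nhds (e 0 : ℝ)) := by
    have : Filter.Tendsto (fun k : ℕ => ∑ i ∈ Finset.range (d + 1),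
      (-1 : ℝ) ^ i * e i * (((k + d - i).choose (d - i) : ℝ) / ((k + d).choose d : ℝ)))
      Filter.atTop (nhds (∑ i ∈ Finset.range (d + 1), if i = 0 then (e 0 : ℝ) else 0)) := by
      refine tendsto_finsetSum _ fun i hi => ?_
      rw [Finset.mem_range] at hi
      split_ifs with h0
      · subst h0
        have : ∀ k : ℕ, ((-1 : ℝ) ^ 0 * e 0 *
          (((k + d - 0).choose (d - 0) : ℝ) / ((k + d).choose d : ℝ))) = e 0 := by
          intro k
          have p1 : ((k + d).choose d : ℝ) ≠ 0 := by
            exact_mod_cast (Nat.choose_pos (by omega)).ne'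
          simp [div_self p1]
        simp only [this]
        exact tendsto_const_nhds
      · have := (choose_ratio_tendsto d i (by omega) (by omega)).const_mul ((-1 : ℝ) ^ i * e i)
        simpa using this
    simp only [Finset.sum_div, ← mul_div_assoc] at this ⊢
    simpa using this
  have hle : (L n : ℝ) / ((n + d).choose d : ℝ) ≤ e 0 := by
    refine ge_of_tendsto ht ?_
    filter_upwards [Filter.eventually_ge_atTop N, Filter.eventually_ge_atTop n] with k hk hnk
    refine (hm hnk).trans ?_
    have := hL k hk
    have h' : (L k : ℝ) ≤ ∑ i ∈ Finset.range (d + 1),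
      (-1 : ℝ) ^ i * e i * ((k + d - i).choose (d - i) : ℝ) := by exact_mod_cast this
    dsimp only
    gcongr
  have p1 : 0 < ((n + d).choose d : ℝ) := by exact_mod_cast Nat.choose_pos (by omega)
  rw [div_le_iff₀ p1] at hle
  rw [mul_comm]
  exact_mod_cast hle

end Stmt8Aux

namespace Stmt8Aux

variable {R : Type u} [CommRing R] [IsLocalRing R] {B : Type u} [CommRing B] [Algebra R B]

lemma sop_comp_perm {d : ℕ} {x : Fin d → R} (hx : IsSOP R x) (σ : Equiv.Perm (Fin d)) :
    IsSOP R (x ∘ σ) := by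
  refine ⟨hx.1, ?_⟩
  rw [σ.surjective.range_comp]
  exact hx.2

lemma sop_pow {d : ℕ} {x : Fin d → R} (hx : IsSOP R x) (t : Fin d → ℕ) (ht : ∀ i, 0 < t i) :
    IsSOP R (fun i => x i ^ t i) := by
  refine ⟨hx.1, ?_⟩
  rw [← hx.2]
  apply le_antisymm
  · apply Ideal.radical_mono
    rw [Ideal.span_le]
    rintro _ ⟨i, rfl⟩
    exact Ideal.pow_mem_of_mem _ (Ideal.subset_span (Set.mem_range_self i)) _ (ht i)
  · apply Ideal.radical_le_radical_iff.mpr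
    rw [Ideal.span_le]
    rintro _ ⟨i, rfl⟩
    exact ⟨t i, Ideal.subset_span ⟨i, rfl⟩⟩

lemma last_regular (hB : IsBalancedBigCM R B) {d : ℕ} {y : Fin (d + 1) → R} (hy : IsSOP R y)
    (b : B) (h : algebraMap R B (y (Fin.last d)) * b ∈
      Ideal.span (Set.range fun j : Fin d => algebraMap R B (y j.castSucc))) :
    b ∈ Ideal.span (Set.range fun j : Fin d => algebraMap R B (y j.castSucc)) := by
  have h1 := (hB.1 _ y hy).toIsWeaklyRegular
  rw [List.ofFn_succ', List.concat_eq_append,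
    RingTheory.Sequence.isWeaklyRegular_append_iff,
    RingTheory.Sequence.isWeaklyRegular_singleton_iff] at h1
  have e : Ideal.ofList (List.ofFn fun j : Fin d => algebraMap R B (y j.castSucc)) =
      Ideal.span (Set.range fun j : Fin d => algebraMap R B (y j.castSucc)) := by
    rw [Ideal.ofList]
    congr 1
    ext z
    simp [List.mem_ofFn]
  have h2 := h1.2
  rw [e, smul_eq_mul, Ideal.mul_top] at h2
  have h3 := h2.right_eq_zero_of_smul (x := Ideal.Quotient.mk _ b)
  rw [← Ideal.Quotient.eq_zero_iff_mem]
  apply h3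
  rw [← Ideal.Quotient.eq_zero_iff_mem] at h
  rw [← h]
  rfl

lemma any_regular (hB : IsBalancedBigCM R B) {d : ℕ} {y : Fin d → R} (hy : IsSOP R y)
    (i : Fin d) (b : B) (h : algebraMap R B (y i) * b ∈
      Ideal.span ((fun j => algebraMap R B (y j)) '' {i}ᶜ)) :
    b ∈ Ideal.span ((fun j => algebraMap R B (y j)) '' {i}ᶜ) := by
  obtain _ | d := d
  · exact i.elim0
  have e : Set.range (fun j : Fin d =>
      algebraMap R B ((y ∘ Equiv.swap i (Fin.last d)) j.castSucc)) =
      (fun j => algebraMap R B (y j)) '' {i}ᶜ := by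
    have : (Set.range fun j : Fin d => Equiv.swap i (Fin.last d) j.castSucc) = {i}ᶜ := by
      ext k
      simp only [Set.mem_range, Set.mem_compl_iff, Set.mem_singleton_iff]
      constructor
      · rintro ⟨j, rfl⟩ hj
        rw [Equiv.swap_apply_eq_iff, Equiv.swap_apply_left] at hj
        exact (Fin.castSucc_lt_last j).ne hj
      · intro hk
        have : Equiv.swap i (Fin.last d) k ≠ Fin.last d := by
          intro h
          rw [Equiv.swap_apply_eq_iff, Equiv.swap_apply_right] at h
          exact hk h
        obtain ⟨j, hj⟩ := Fin.exists_castSucc_eq.mpr this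
        exact ⟨j, by rw [hj, Equiv.swap_apply_self]⟩
    rw [← this, ← Set.range_comp]
    rfl
  have := last_regular hB (sop_comp_perm hy (Equiv.swap i (Fin.last d))) b
  rw [e] at this
  apply this
  simpa using h

lemma step (hB : IsBalancedBigCM R B) {d : ℕ} {x : Fin d → R} (hx : IsSOP R x)
    (t : Fin d → ℕ) (ht : ∀ i, 0 < t i) (i : Fin d) (a : ℕ) (c : B)
    (h : c * algebraMap R B (x i) ^ a ∈ Ideal.span
      (Set.range fun j => algebraMap R B (x j) ^ (Function.update t i (a + 1) j))) :
    c ∈ Ideal.span (Set.range fun j => algebraMap R B (x j) ^ (Function.update t i 1 j)) := by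
  set I := Ideal.span ((fun j => algebraMap R B (x j) ^ t j) '' {i}ᶜ) with hI
  have key : ∀ m, Ideal.span
      (Set.range fun j => algebraMap R B (x j) ^ (Function.update t i m j)) =
      Ideal.span {algebraMap R B (x i) ^ m} ⊔ I := by
    intro m
    rw [hI, ← Ideal.span_union]
    congr 1
    rw [← Set.image_univ, ← Set.union_compl_self {i}, Set.image_union, Set.image_singleton]
    congr 1
    · simp
    · refine Set.image_congr fun j hj => ?_
      rw [Function.update_of_ne (by simpa using hj)]
  have reg : ∀ b, algebraMap R B (x i) * b ∈ I → b ∈ I := by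
    intro b hb
    have hs := sop_pow hx (Function.update t i 1) (fun j => by
      by_cases hj : j = i
      · subst hj; simp
      · rw [Function.update_of_ne hj]; exact ht j)
    have e : (fun j => algebraMap R B (x j ^ Function.update t i 1 j)) '' {i}ᶜ =
        (fun j => algebraMap R B (x j) ^ t j) '' {i}ᶜ := by
      refine Set.image_congr fun j hj => ?_
      rw [Function.update_of_ne (by simpa using hj), map_pow]
    have := any_regular hB hs i b
    rw [e] at this
    apply this
    simpa using hb
  have reg' : ∀ (n : ℕ) b, algebraMap R B (x i) ^ n * b ∈ I → b ∈ I := by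
    intro n
    induction n with
    | zero => intro b hb; simpa using hb
    | succ n ih =>
      intro b hb
      apply ih
      apply reg
      rwa [← mul_assoc, ← pow_succ']
  rw [key, Ideal.mem_span_singleton_sup] at h
  obtain ⟨u, v, hv, huv⟩ := h
  rw [key, Ideal.mem_span_singleton_sup]
  refine ⟨u, c - u * algebraMap R B (x i), ?_, by ring⟩
  apply reg' a
  have : algebraMap R B (x i) ^ a * (c - u * algebraMap R B (x i)) = v := by
    linear_combination -huv
  rwa [this]

lemma factA (hB : IsBalancedBigCM R B) {d : ℕ} {x : Fin d → R} (hx : IsSOP R x)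
    (a : Fin d → ℕ) (b : B)
    (h : b * ∏ i, algebraMap R B (x i) ^ a i ∈ Ideal.span
      (Set.range fun j => algebraMap R B (x j) ^ (a j + 1))) :
    b ∈ Ideal.span (Set.range fun j => algebraMap R B (x j)) := by
  have key : ∀ s : Finset (Fin d), b * ∏ i ∈ s, algebraMap R B (x i) ^ a i ∈ Ideal.span
      (Set.range fun j => algebraMap R B (x j) ^ (if j ∈ s then a j + 1 else 1)) →
      b ∈ Ideal.span (Set.range fun j => algebraMap R B (x j)) := by
    intro s
    induction s using Finset.induction_on with
    | empty => intro h; simpa using h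
    | insert i s his ih =>
      intro h
      apply ih
      have := step hB hx (fun j => if j ∈ s then a j + 1 else 1)
        (fun j => by split_ifs <;> omega) i (a i)
        (b * ∏ i ∈ s, algebraMap R B (x i) ^ a i)
      have e1 : Function.update (fun j => if j ∈ s then a j + 1 else 1) i 1 =
          fun j => if j ∈ s then a j + 1 else 1 := by
        rw [Function.update_eq_self_iff]; simp [his]
      have e2 : Function.update (fun j => if j ∈ s then a j + 1 else 1) i (a i + 1) =
          fun j => if j ∈ insert i s then a j + 1 else 1 := by
        ext j
        by_cases hj : j = i
        · subst hj; simp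
        · rw [Function.update_of_ne hj]; simp [hj]
      rw [e1, e2] at this
      apply this
      rw [Finset.prod_insert his] at h
      convert h using 1
      ring
  apply key Finset.univ
  simpa using h

end Stmt8Aux

namespace Stmt8Aux

variable {R : Type u} [CommRing R] {B : Type u} [CommRing B] [Algebra R B]

/-- monomial in the images of `x` -/
noncomputable def mon (B : Type u) [CommRing B] [Algebra R B] {d : ℕ} (x : Fin d → R)
    (a : Fin d →₀ ℕ) : B :=
  ∏ i, algebraMap R B (x i) ^ a i

lemma mon_add {d : ℕ} (x : Fin d → R) (a b : Fin d →₀ ℕ) :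
    mon B x (a + b) = mon B x a * mon B x b := by
  simp [mon, pow_add, Finset.prod_mul_distrib]

lemma mon_single {d : ℕ} (x : Fin d → R) (i : Fin d) :
    mon B x (Finsupp.single i 1) = algebraMap R B (x i) := by
  rw [mon, Finset.prod_eq_single i]
  · simp
  · intro j _ hj
    simp [Finsupp.single_apply, hj.symm]
  · simp

/-- monomial ideal of `B` -/
noncomputable def monI (B : Type u) [CommRing B] [Algebra R B] {d : ℕ} (x : Fin d → R)
    (S : Set (Fin d →₀ ℕ)) : Ideal B :=
  Ideal.span (mon B x '' S)

/-- its contraction -/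
noncomputable def conI (B : Type u) [CommRing B] [Algebra R B] {d : ℕ} (x : Fin d → R)
    (S : Set (Fin d →₀ ℕ)) : Ideal R :=
  (monI B x S).comap (algebraMap R B)

lemma conI_mono {d : ℕ} (x : Fin d → R) {S T : Set (Fin d →₀ ℕ)} (h : S ⊆ T) :
    conI B x S ≤ conI B x T :=
  Ideal.comap_mono (Ideal.span_mono (Set.image_mono h))

/-- exponents at least `a` -/
def up {d : ℕ} (a : Fin d →₀ ℕ) : Set (Fin d →₀ ℕ) := {b | toDegLex a ≤ toDegLex b}

/-- exponents strictly above `a` -/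
def upS {d : ℕ} (a : Fin d →₀ ℕ) : Set (Fin d →₀ ℕ) := {b | toDegLex a < toDegLex b}

lemma upS_subset {d : ℕ} (a : Fin d →₀ ℕ) : upS a ⊆ up a := fun b h =>
  (show toDegLex a ≤ toDegLex b from le_of_lt h)

lemma up_eq {d : ℕ} (a : Fin d →₀ ℕ) : up a = insert a (upS a) := by
  ext b
  simp only [up, upS, Set.mem_ofPred_eq, Set.mem_insert_iff]
  rw [le_iff_eq_or_lt, toDegLex_inj, eq_comm]

lemma mul_upS {d : ℕ} (x : Fin d → R) (a c : Fin d →₀ ℕ) (s : B)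
    (hs : s ∈ monI B x (upS a)) : mon B x c * s ∈ monI B x (upS (a + c)) := by
  have : monI B x (upS a) ≤ Submodule.comap (LinearMap.mulLeft B (mon B x c)) (monI B x (upS (a + c))) := by
    rw [monI, Ideal.span_le]
    rintro _ ⟨b, hb, rfl⟩
    simp only [SetLike.mem_coe, Submodule.mem_comap, LinearMap.mulLeft_apply]
    rw [← mon_add]
    refine Ideal.subset_span ⟨c + b, ?_, rfl⟩
    simp only [upS, Set.mem_ofPred_eq, toDegLex_add] at hb ⊢
    rw [add_comm]
    exact add_lt_add_right hb _
  exact this hs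

lemma mul_up {d : ℕ} (x : Fin d → R) (a c : Fin d →₀ ℕ) (s : B)
    (hs : s ∈ monI B x (up a)) : mon B x c * s ∈ monI B x (up (a + c)) := by
  have : monI B x (up a) ≤ Submodule.comap (LinearMap.mulLeft B (mon B x c)) (monI B x (up (a + c))) := by
    rw [monI, Ideal.span_le]
    rintro _ ⟨b, hb, rfl⟩
    simp only [SetLike.mem_coe, Submodule.mem_comap, LinearMap.mulLeft_apply]
    rw [← mon_add]
    refine Ideal.subset_span ⟨c + b, ?_, rfl⟩
    simp only [up, Set.mem_ofPred_eq, toDegLex_add] at hb ⊢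
    rw [add_comm]
    exact add_le_add_right hb _
  exact this hs

lemma lt_add_single {d : ℕ} (a : Fin d →₀ ℕ) (i : Fin d) :
    toDegLex a < toDegLex (a + Finsupp.single i 1) := by
  rw [Finsupp.DegLex.lt_iff]
  left
  simp

lemma degLex_mono {d : ℕ} {a b : Fin d →₀ ℕ} (h : a ≤ b) : toDegLex a ≤ toDegLex b := by
  obtain ⟨c, rfl⟩ := exists_add_of_le h
  rw [toDegLex_add]
  have : (0 : DegLex (Fin d →₀ ℕ)) ≤ toDegLex c := bot_le
  exact le_add_of_nonneg_right this

lemma colon_upS [IsLocalRing R] (hB : IsBalancedBigCM R B) {d : ℕ} {x : Fin d → R}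
    (hx : IsSOP R x) (a : Fin d →₀ ℕ) (b : B) (h : b * mon B x a ∈ monI B x (upS a)) :
    b ∈ Ideal.span (Set.range fun j => algebraMap R B (x j)) := by
  refine factA hB hx a b ?_
  refine (Ideal.span_le.mpr ?_ : monI B x (upS a) ≤ _) h
  rintro _ ⟨c, hc, rfl⟩
  have : ¬ c ≤ a := fun hca => absurd (degLex_mono hca) (not_le.mpr hc)
  rw [Finsupp.le_def] at this
  push Not at this
  obtain ⟨i, hi⟩ := this
  refine Ideal.mem_of_dvd _ ?_ (Ideal.subset_span (Set.mem_range_self i))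
  exact (pow_dvd_pow _ hi).trans
    (Finset.dvd_prod_of_mem (fun i => algebraMap R B (x i) ^ c i) (Finset.mem_univ i))

lemma key_inj [IsLocalRing R] (hB : IsBalancedBigCM R B) {d : ℕ} {x : Fin d → R}
    (hx : IsSOP R x) (a : Fin d →₀ ℕ) (i : Fin d) (r : R) (hr : r ∈ conI B x (up a))
    (h : x i * r ∈ conI B x (upS (a + Finsupp.single i 1))) : r ∈ conI B x (upS a) := by
  rw [conI, Ideal.mem_comap] at *
  rw [map_mul, ← mon_single] at h
  rw [up_eq, monI, Set.image_insert_eq, Ideal.mem_span_insert] at hr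
  obtain ⟨b, s, hs, hbs⟩ := hr
  change s ∈ monI B x (upS a) at hs
  have h1 := mul_upS x a (Finsupp.single i 1) s hs
  have h2 : b * mon B x (a + Finsupp.single i 1) ∈
      monI B x (upS (a + Finsupp.single i 1)) := by
    have := Ideal.sub_mem _ h h1
    convert this using 1
    rw [hbs, mon_add]
    ring
  have h3 := colon_upS hB hx _ b h2
  rw [hbs]
  refine Ideal.add_mem _ ?_ hs
  have h4 : Ideal.span (Set.range fun j => algebraMap R B (x j)) ≤
      Submodule.comap (LinearMap.mulRight B (mon B x a)) (monI B x (upS a)) := by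
    rw [Ideal.span_le]
    rintro _ ⟨j, rfl⟩
    simp only [SetLike.mem_coe, Submodule.mem_comap, LinearMap.mulRight_apply]
    rw [← mon_single, ← mon_add, add_comm]
    exact Ideal.subset_span ⟨_, lt_add_single a j, rfl⟩
  exact h4 h3

/-- length of the graded piece -/
noncomputable def piece (B : Type u) [CommRing B] [Algebra R B] {d : ℕ} (x : Fin d → R)
    (a : Fin d →₀ ℕ) : ℕ∞ :=
  Module.length R (conI B x (up a) ⧸ (conI B x (upS a)).submoduleOf (conI B x (up a)))

lemma piece_le [IsLocalRing R] (hB : IsBalancedBigCM R B) {d : ℕ} {x : Fin d → R}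
    (hx : IsSOP R x) (a : Fin d →₀ ℕ) (i : Fin d) :
    piece B x a ≤ piece B x (a + Finsupp.single i 1) := by
  have hmul : ∀ r ∈ conI B x (up a), x i * r ∈ conI B x (up (a + Finsupp.single i 1)) := by
    intro r hr
    rw [conI, Ideal.mem_comap] at *
    rw [map_mul, ← mon_single]
    exact mul_up x a _ _ hr
  have hmulS : ∀ r ∈ conI B x (upS a), x i * r ∈ conI B x (upS (a + Finsupp.single i 1)) := by
    intro r hr
    rw [conI, Ideal.mem_comap] at *
    rw [map_mul, ← mon_single]
    exact mul_upS x a _ _ hr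
  let g : conI B x (up a) →ₗ[R] conI B x (up (a + Finsupp.single i 1)) :=
    (LinearMap.mulLeft R (x i)).restrict hmul
  let G := Submodule.mapQ ((conI B x (upS a)).submoduleOf (conI B x (up a)))
    ((conI B x (upS (a + Finsupp.single i 1))).submoduleOf
      (conI B x (up (a + Finsupp.single i 1)))) g (fun r hr => hmulS _ hr)
  refine Module.length_le_of_injective G ?_
  rw [← LinearMap.ker_eq_bot]
  refine Submodule.ker_liftQ_eq_bot _ _ _ ?_
  intro r hr
  rw [LinearMap.ker_comp, Submodule.ker_mkQ] at hr
  exact key_inj hB hx a i r r.2 hr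

lemma length_step {d : ℕ} (x : Fin d → R) (a : Fin d →₀ ℕ) :
    Module.length R (R ⧸ conI B x (upS a)) =
      piece B x a + Module.length R (R ⧸ conI B x (up a)) := by
  have hle : conI B x (upS a) ≤ conI B x (up a) := conI_mono x (upS_subset a)
  refine Module.length_eq_add_of_exact
    (Submodule.mapQ ((conI B x (upS a)).submoduleOf (conI B x (up a))) (conI B x (upS a))
      (conI B x (up a)).subtype le_rfl)
    (Submodule.factor hle) ?_ (Submodule.factor_surjective hle) ?_
  · rw [← LinearMap.ker_eq_bot]
    exact Submodule.ker_liftQ_eq_bot _ _ _ (by simp [LinearMap.ker_comp, Submodule.submoduleOf])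
  · intro z
    obtain ⟨r, rfl⟩ := Submodule.Quotient.mk_surjective _ z
    constructor
    · intro h
      have : r ∈ conI B x (up a) := by
        rw [← Submodule.Quotient.mk_eq_zero]
        exact h
      exact ⟨Submodule.Quotient.mk ⟨r, this⟩, rfl⟩
    · rintro ⟨y, hy⟩
      obtain ⟨y, rfl⟩ := Submodule.Quotient.mk_surjective _ y
      rw [← hy]
      exact (Submodule.Quotient.mk_eq_zero _).mpr y.2

lemma length_sum {d : ℕ} (x : Fin d → R) (m : ℕ) : ∀ (T : Finset (Fin d →₀ ℕ)), T.card = m →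
    (∀ a ∈ T, ∀ b, toDegLex b ≤ toDegLex a → b ∈ T) →
    Module.length R (R ⧸ conI B x ((T : Set (Fin d →₀ ℕ))ᶜ)) = ∑ a ∈ T, piece B x a := by
  induction m with
  | zero =>
    intro T hT _
    rw [Finset.card_eq_zero] at hT
    subst hT
    have : conI B x (((∅ : Finset (Fin d →₀ ℕ)) : Set (Fin d →₀ ℕ))ᶜ) = ⊤ := by
      rw [Ideal.eq_top_iff_one, conI, Ideal.mem_comap, map_one]
      exact Ideal.subset_span ⟨0, by simp, by simp [mon]⟩
    rw [this, Finset.sum_empty, Module.length_eq_zero_iff]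
    exact Ideal.Quotient.subsingleton_iff.mpr rfl
  | succ m ih =>
    intro T hT hlow
    have hne : T.Nonempty := by
      rw [← Finset.card_pos]; omega
    obtain ⟨a, haT, hmax⟩ := Finset.exists_max_image T (fun b => toDegLex b) hne
    have e1 : ((T : Set (Fin d →₀ ℕ))ᶜ) = upS a := by
      ext b
      simp only [Set.mem_compl_iff, Finset.mem_coe, upS, Set.mem_ofPred_eq]
      rw [← not_le]
      exact not_congr ⟨fun h => hmax b h, fun h => hlow a haT b h⟩
    have e2 : (((T.erase a : Finset _) : Set (Fin d →₀ ℕ))ᶜ) = up a := by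
      rw [up_eq, ← e1]
      ext b
      simp only [Finset.coe_erase, Set.mem_compl_iff, Set.mem_sdiff, Set.mem_insert_iff,
        Set.mem_singleton_iff]
      tauto
    rw [e1, length_step, ← Finset.add_sum_erase T _ haT, ← e2, ih]
    · rw [Finset.card_erase_of_mem haT]; omega
    · intro c hc b hbc
      rw [Finset.mem_erase] at *
      refine ⟨?_, hlow c hc.2 b hbc⟩
      rintro rfl
      exact hc.1 (toDegLex_injective (le_antisymm (hmax c hc.2) hbc))

lemma monI_expSet {d : ℕ} (x : Fin d → R) (n : ℕ) :
    monI B x {a | n ≤ ∑ i, a i} =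
      ((Ideal.span (Set.range x)) ^ n).map (algebraMap R B) := by
  apply le_antisymm
  · rw [monI, Ideal.span_le]
    rintro _ ⟨a, ha, rfl⟩
    refine Ideal.map_mono (Ideal.pow_le_pow_right ha) ?_
    rw [mon, ← Finset.prod_pow_eq_pow_sum]
    simp only [← map_pow, ← map_prod]
    refine Ideal.mem_map_of_mem _ (Ideal.prod_mem_prod fun i _ => ?_)
    exact Ideal.pow_mem_pow (Ideal.subset_span (Set.mem_range_self i)) _
  · rw [Ideal.map_pow, Ideal.map_span, ← Set.range_comp]
    induction n with
    | zero =>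
      rw [pow_zero, Ideal.one_eq_top, top_le_iff, Ideal.eq_top_iff_one]
      exact Ideal.subset_span ⟨0, by simp, by simp [mon]⟩
    | succ n ih =>
      rw [pow_succ]
      refine (Ideal.mul_mono_left ih).trans ?_
      rw [monI, monI, Ideal.span_mul_span', Ideal.span_le]
      rintro _ ⟨_, ⟨a, ha, rfl⟩, _, ⟨i, rfl⟩, rfl⟩
      refine Ideal.subset_span ⟨a + Finsupp.single i 1, ?_, ?_⟩
      · simpa [Finset.sum_add_distrib, Finsupp.single_apply] using ha
      · rw [mon_add, mon_single]; rfl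

lemma length_contracted {d : ℕ} (x : Fin d → R) (n : ℕ) :
    Module.length R (R ⧸ contractedExt R (algebraMap R B) ((Ideal.span (Set.range x)) ^ (n + 1)))
      = ∑ a ∈ expSet d n, piece B x a := by
  rw [← length_sum x _ (expSet d n) rfl]
  · have : contractedExt R (algebraMap R B) ((Ideal.span (Set.range x)) ^ (n + 1)) =
        conI B x ((expSet d n : Set (Fin d →₀ ℕ))ᶜ) := by
      rw [contractedExt, ← monI_expSet, conI]
      congr 2
      ext a
      simp [mem_expSet]
    rw [this]
  · intro a ha b hb
    rw [mem_expSet] at *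
    have := Finsupp.DegLex.monotone_degree hb
    simp only [ofDegLex_toDegLex, Finsupp.degree_eq_sum] at this
    omega

end Stmt8Aux

theorem stmt8 (R : Type u) [CommRing R] [IsLocalRing R] [IsNoetherianRing R]
    (d : ℕ) (hd : ringKrullDim R = (d : WithBot ℕ∞))
    (Q : Ideal R) (hQ : IsParameterIdeal R Q)
    (B : Type u) [CommRing B] [Algebra R B] (hB : IsBalancedBigCM R B)
    (e : ℕ → ℤ) (he : HasHilbertSeries R d (fun n => Q ^ n) e)
    (n : ℕ) :
    ∃ m : ℕ,
      moduleLength R (R ⧸ contractedExt R (algebraMap R B) (Q ^ (n + 1))) = (m : WithBot ℕ∞) ∧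
      (m : ℤ) ≤ ((n + d).choose d : ℤ) * e 0 := by
  obtain ⟨d', x, hx, rfl⟩ := hQ
  obtain rfl : d' = d := by
    have := hx.1
    rw [hd] at this
    exact_mod_cast this.symm
  obtain ⟨N, hN⟩ := he
  have hlen : ∀ k, Module.length R (R ⧸ contractedExt R (algebraMap R B)
      ((Ideal.span (Set.range x)) ^ (k + 1))) = ∑ a ∈ Stmt8Aux.expSet d' k,
        Stmt8Aux.piece B x a := Stmt8Aux.length_contracted x
  have hbd : ∀ k ≥ N, ∃ m : ℕ, ∑ a ∈ Stmt8Aux.expSet d' k, Stmt8Aux.piece B x a ≤ (m : ℕ∞) ∧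
      (m : ℤ) = ∑ i ∈ Finset.range (d' + 1),
        (-1) ^ i * e i * ((k + d' - i).choose (d' - i) : ℤ) := by
    intro k hk
    obtain ⟨m, hm, hm'⟩ := hN k hk
    refine ⟨m, ?_, hm'⟩
    rw [moduleLength, ← Module.coe_length] at hm
    have hm2 : Module.length R (R ⧸ (Ideal.span (Set.range x)) ^ (k + 1)) = (m : ℕ∞) := by
      exact_mod_cast hm
    rw [← hlen, ← hm2]
    have hle : (Ideal.span (Set.range x)) ^ (k + 1) ≤ contractedExt R (algebraMap R B)
      ((Ideal.span (Set.range x)) ^ (k + 1)) := Ideal.le_comap_map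
    exact Module.length_le_of_surjective (Submodule.factor hle) (Submodule.factor_surjective hle)
  have hfin : ∀ a, Stmt8Aux.piece B x a ≠ ⊤ := by
    intro a
    obtain ⟨m, hm, -⟩ := hbd (max N (∑ i, a i)) (le_max_left _ _)
    refine ne_top_of_le_ne_top (ENat.coe_ne_top m) (le_trans ?_ hm)
    exact Finset.single_le_sum (f := fun a => Stmt8Aux.piece B x a) (fun _ _ => zero_le)
      ((Stmt8Aux.mem_expSet a).mpr (le_max_right _ _))
  choose f hf using fun a => ENat.ne_top_iff_exists.mp (hfin a)
  have hsum : ∀ k, ∑ a ∈ Stmt8Aux.expSet d' k, Stmt8Aux.piece B x a =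
      ((∑ a ∈ Stmt8Aux.expSet d' k, f a : ℕ) : ℕ∞) := by
    intro k
    rw [Nat.cast_sum]
    exact Finset.sum_congr rfl fun a _ => (hf a).symm
  refine ⟨∑ a ∈ Stmt8Aux.expSet d' n, f a, ?_, ?_⟩
  · rw [moduleLength, ← Module.coe_length, hlen, hsum]
    rfl
  · refine Stmt8Aux.numeric (fun k => ∑ a ∈ Stmt8Aux.expSet d' k, f a) e N ?_ ?_ n
    · refine Stmt8Aux.urn f fun a i => ?_
      have := Stmt8Aux.piece_le hB hx a i
      rw [← hf, ← hf] at this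
      exact_mod_cast this
    · intro k hk
      obtain ⟨m, hm, hm'⟩ := hbd k hk
      rw [← hm']
      rw [hsum] at hm
      exact_mod_cast hm
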